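/- For every s > 0 and any two distinct sites u ≠ v of the triangular lattice Λ_s with edge length s, the flower regions around u and v are essentially disjoint: vol(F(u) ∩ F(v)) = 0 (their interiors are disjoint). -/

import Mathlib

open MeasureTheory Metric Real

/-- The point `(a, b)` of the Euclidean plane. -/
noncomputable def planePt (a b : ℝ) : EuclideanSpace ℝ (Fin 2) :=
  (WithLp.equiv 2 (Fin 2 → ℝ)).symm ![a, b]

/-- The triangular lattice with edge length `s`:
`Λ_s = {i·s·(1,0) + j·s·(1/2, √3/2) : i, j ∈ ℤ}`. -/
noncomputable def triLattice (s : ℝ) : Set (EuclideanSpace ℝ (Fin 2)) :=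
  {v | ∃ i j : ℤ, v = ((i : ℝ) * s) • planePt 1 0
    + ((j : ℝ) * s) • planePt (1 / 2) (Real.sqrt 3 / 2)}

/-- The flower region around a site `v` of the triangular lattice with edge length `s`:
the intersection of the six closed disks of radius `s` centered at the midpoints
`v + (s/2)·(cos(kπ/3), sin(kπ/3))`, `k = 0,…,5`, of the edges incident to `v`. -/
noncomputable def flower (s : ℝ) (v : EuclideanSpace ℝ (Fin 2)) :
    Set (EuclideanSpace ℝ (Fin 2)) :=
  ⋂ k : Fin 6, closedBall
    (v + (s / 2) • planePt (Real.cos ((k : ℕ) * Real.pi / 3))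
      (Real.sin ((k : ℕ) * Real.pi / 3))) s

theorem volume_closedBall_inter_closedBall_eq_zero {s : ℝ} (hs : s ≠ 0)
    {c c' : EuclideanSpace ℝ (Fin 2)} (h : 2 * s ≤ dist c c') :
    volume (closedBall c s ∩ closedBall c' s) = 0 := by
  refine measure_mono_null ?_ (Measure.addHaar_sphere_of_ne_zero volume c hs)
  rintro p ⟨hp, hp'⟩
  rw [mem_closedBall] at hp hp'
  rw [mem_sphere]
  linarith [dist_triangle_left c c' p]

theorem inner_planePt (a b c d : ℝ) :
    inner ℝ (planePt a b) (planePt c d) = a * c + b * d := by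
  simp [planePt, PiLp.inner_apply, Fin.sum_univ_two, mul_comm]

theorem norm_planePt_cos_sin (θ : ℝ) : ‖planePt (cos θ) (sin θ)‖ = 1 := by
  have h : ‖planePt (cos θ) (sin θ)‖ ^ 2 = 1 := by
    rw [← real_inner_self_eq_norm_sq, inner_planePt]
    linarith [cos_sq_add_sin_sq θ]
  exact (pow_eq_one_iff_of_nonneg (norm_nonneg _) two_ne_zero).1 h

/-- The edge directions `k` and `k + 3` are opposite. -/
theorem planePt_opposite (k : Fin 6) :
    planePt (cos (((k + 3 : Fin 6) : ℕ) * π / 3)) (sin (((k + 3 : Fin 6) : ℕ) * π / 3)) =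
      -planePt (cos ((k : ℕ) * π / 3)) (sin ((k : ℕ) * π / 3)) := by
  have key : cos (((k + 3 : Fin 6) : ℕ) * π / 3) = -cos ((k : ℕ) * π / 3) ∧
      sin (((k + 3 : Fin 6) : ℕ) * π / 3) = -sin ((k : ℕ) * π / 3) := by
    rcases lt_or_ge (k : ℕ) 3 with hk | hk
    · have hval : ((k + 3 : Fin 6) : ℕ) = (k : ℕ) + 3 := by
        rw [Fin.val_add]; exact Nat.mod_eq_of_lt (by simp; omega)
      have hangle : (((k : ℕ) + 3 : ℕ) : ℝ) * π / 3 = (k : ℕ) * π / 3 + π := by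
        push_cast; ring
      rw [hval, hangle, cos_add_pi, sin_add_pi]
      exact ⟨rfl, rfl⟩
    · have hval : (k : ℕ) = ((k + 3 : Fin 6) : ℕ) + 3 := by
        rw [Fin.val_add]; have := k.isLt; simp; omega
      have hangle : ((k : ℕ) : ℝ) * π / 3 = ((k + 3 : Fin 6) : ℕ) * π / 3 + π := by
        have : ((k : ℕ) : ℝ) = ((k + 3 : Fin 6) : ℕ) + 3 := by exact_mod_cast hval
        rw [this]; ring
      rw [hangle, cos_add_pi, sin_add_pi, neg_neg, neg_neg]
      exact ⟨rfl, rfl⟩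
  rw [key.1, key.2]
  ext l
  fin_cases l <;> simp [planePt]

/-- If `v` lies at least `s` ahead of `u` in an edge direction, then the disk of `flower s u`
centered behind `u` and the disk of `flower s v` centered ahead of `v` overlap in a null set. -/
theorem volume_flower_inter_eq_zero_of_le_inner {s : ℝ} (hs : 0 < s)
    {u v : EuclideanSpace ℝ (Fin 2)} (k : Fin 6)
    (h : s ≤ inner ℝ (v - u) (planePt (cos ((k : ℕ) * π / 3)) (sin ((k : ℕ) * π / 3)))) :
    volume (flower s u ∩ flower s v) = 0 := by
  refine measure_mono_null (Set.inter_subset_inter (Set.iInter_subset _ (k + 3))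
    (Set.iInter_subset _ k)) (volume_closedBall_inter_closedBall_eq_zero hs.ne' ?_)
  rw [planePt_opposite]
  have hnorm := norm_planePt_cos_sin ((k : ℕ) * π / 3)
  generalize planePt (cos ((k : ℕ) * π / 3)) (sin ((k : ℕ) * π / 3)) = e at h hnorm ⊢
  have hdiff : v + (s / 2) • e - (u + (s / 2) • -e) = (v - u) + s • e := by module
  have hinner : inner ℝ ((v - u) + s • e) e = inner ℝ (v - u) e + s := by
    rw [inner_add_left, real_inner_smul_left, real_inner_self_eq_norm_sq, hnorm]; ring
  have hcs := real_inner_le_norm ((v - u) + s • e) e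
  rw [dist_comm, dist_eq_norm, hdiff]
  rw [hinner, hnorm] at hcs
  linarith

/-- A lower bound on an absolute component holds without absolute value in that edge direction or
the opposite one. -/
theorem exists_edge_direction_of_le_abs {x y : ℝ} (k : Fin 6)
    (h : 1 ≤ |x * cos ((k : ℕ) * π / 3) + y * sin ((k : ℕ) * π / 3)|) :
    ∃ l : Fin 6, 1 ≤ x * cos ((l : ℕ) * π / 3) + y * sin ((l : ℕ) * π / 3) := by
  rcases le_abs.1 h with h | h
  · exact ⟨k, h⟩
  · refine ⟨k + 3, ?_⟩
    have hopp := congrArg (inner ℝ (planePt x y)) (planePt_opposite k)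
    rw [inner_neg_right, inner_planePt, inner_planePt] at hopp
    rwa [hopp]

/-- A nonzero point of the unit triangular lattice reaches at least distance `1` in some edge
direction. -/
theorem exists_edge_direction_one_le {i j : ℤ} (hij : ¬(i = 0 ∧ j = 0)) :
    ∃ k : Fin 6, 1 ≤ ((i : ℝ) + j / 2) * cos ((k : ℕ) * π / 3) +
      (j * (√3 / 2)) * sin ((k : ℕ) * π / 3) := by
  have h3 : √3 * √3 = 3 := mul_self_sqrt (by norm_num)
  have hcos : cos (2 * π / 3) = -(1 / 2) := by
    rw [show 2 * π / 3 = π - π / 3 by ring, cos_pi_sub, cos_pi_div_three]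
  have hsin : sin (2 * π / 3) = √3 / 2 := by
    rw [show 2 * π / 3 = π - π / 3 by ring, sin_pi_sub, sin_pi_div_three]
  have half {n : ℤ} (hn : 2 ≤ |n|) : 1 ≤ |(n : ℝ) / 2| := by
    have : (2 : ℝ) ≤ |(n : ℝ)| := by exact_mod_cast hn
    rw [abs_div, abs_two]; linarith
  have hcases : 2 ≤ |2 * i + j| ∨ 2 ≤ |i + 2 * j| ∨ 2 ≤ |j - i| := by
    simp only [le_abs]; omega
  rcases hcases with h | h | h
  · refine exists_edge_direction_of_le_abs 0 ?_
    convert half h using 2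
    push_cast; simp; ring
  · refine exists_edge_direction_of_le_abs 1 ?_
    convert half h using 2
    simp only [Fin.val_one, Nat.cast_one, one_mul, cos_pi_div_three, sin_pi_div_three]
    push_cast; linear_combination (j / 4 : ℝ) * h3
  · refine exists_edge_direction_of_le_abs 2 ?_
    convert half h using 2
    simp only [Fin.val_two, Nat.cast_ofNat, hcos, hsin]
    push_cast; linear_combination (j / 4 : ℝ) * h3

/-- The flower regions around distinct sites of the triangular lattice
with edge length `s` are essentially disjoint: `vol(F(u) ∩ F(v)) = 0`. -/
theorem flower_essentially_disjoint (s : ℝ) (hs : 0 < s)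
    (u v : EuclideanSpace ℝ (Fin 2)) (hu : u ∈ triLattice s) (hv : v ∈ triLattice s)
    (huv : u ≠ v) :
    volume (flower s u ∩ flower s v) = 0 := by
  obtain ⟨i, j, rfl⟩ := hu
  obtain ⟨i', j', rfl⟩ := hv
  have hne : ¬(i' - i = 0 ∧ j' - j = 0) := by
    rintro ⟨hi, hj⟩
    exact huv (by rw [sub_eq_zero.1 hi, sub_eq_zero.1 hj])
  obtain ⟨k, hk⟩ := exists_edge_direction_one_le hne
  refine volume_flower_inter_eq_zero_of_le_inner hs k ?_
  simp only [inner_sub_left, inner_add_left, real_inner_smul_left, inner_planePt]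
  push_cast at hk
  linear_combination s * hk
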